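/- Let p ∈ (0,∞) and let (P̂, Δ(·), P(·), I) be a Mahler sliding family in ℝ² with 0 ∈ int P̂. For any t, t' ∈ I there exists x_0 ∈ ℝ with (x_0,0) ∈ int P(t) and (−x_0,0) ∈ int P(t') such that, setting A := (P(t)−(x_0,0))^{∘,p} and B := (P(t')+(x_0,0))^{∘,p}, one has |A ∩ {(x,y): x>0}| · |B ∩ {(x,y): x<0}| = |A ∩ {(x,y): x<0}| · |B ∩ {(x,y): x>0}| (all four volumes being finite). -/

import Mathlib

open MeasureTheory Set

/-- The `L^p`-support function of a body `K ⊆ ℝ²`. -/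
noncomputable def suppFn (p : ℝ) (K : Set (ℝ × ℝ)) (y : ℝ × ℝ) : ℝ :=
  (1 / p) * Real.log ((∫ x in K, Real.exp (p * (x.1 * y.1 + x.2 * y.2))) / (volume K).toReal)

/-- The `L^p`-Mahler volume of `K ⊆ ℝ²`. -/
noncomputable def mahlerVol (p : ℝ) (K : Set (ℝ × ℝ)) : ℝ :=
  (volume K).toReal * ∫ y, Real.exp (-(suppFn p K y))

/-- The near norm of the `L^p`-polar body, for `n = 2`. -/
noncomputable def nearNorm (p : ℝ) (K : Set (ℝ × ℝ)) (y : ℝ × ℝ) : ℝ :=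
  if y = 0 then 0
  else (∫ r in Set.Ioi (0 : ℝ), r * Real.exp (-(suppFn p K (r • y)))) ^ (-(1 / 2 : ℝ))

/-- The `L^p`-polar body of `K ⊆ ℝ²`. -/
noncomputable def lpPolar (p : ℝ) (K : Set (ℝ × ℝ)) : Set (ℝ × ℝ) :=
  {y | nearNorm p K y ≤ 1}

lemma integrableOn_exp_dot (p : ℝ) {K : Set (ℝ × ℝ)} (hK : IsCompact K) (y : ℝ × ℝ) :
    IntegrableOn (fun x : ℝ × ℝ => Real.exp (p * (x.1 * y.1 + x.2 * y.2))) K :=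
  ContinuousOn.integrableOn_compact hK (by fun_prop)

lemma toReal_volume_pos {K : Set (ℝ × ℝ)} (hK : IsCompact K) (hne : (interior K).Nonempty) :
    0 < (volume K).toReal :=
  ENNReal.toReal_pos (Measure.measure_pos_of_nonempty_interior volume hne).ne' hK.measure_lt_top.ne

lemma setIntegral_exp_dot_pos (p : ℝ) {K : Set (ℝ × ℝ)} (hK : IsCompact K)
    (hne : (interior K).Nonempty) (y : ℝ × ℝ) :
    0 < ∫ x in K, Real.exp (p * (x.1 * y.1 + x.2 * y.2)) := by
  rw [setIntegral_pos_iff_support_of_nonneg_ae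
    (Filter.Eventually.of_forall fun x => (Real.exp_pos _).le) (integrableOn_exp_dot p hK y)]
  have : Function.support (fun x : ℝ × ℝ => Real.exp (p * (x.1 * y.1 + x.2 * y.2))) = univ := by
    ext x; simp [Real.exp_ne_zero]
  rw [this, univ_inter]
  exact Measure.measure_pos_of_nonempty_interior volume hne

lemma measurable_suppFn (p : ℝ) (K : Set (ℝ × ℝ)) : Measurable (suppFn p K) := by
  have h : StronglyMeasurable fun y : ℝ × ℝ =>
      ∫ x in K, Real.exp (p * (x.1 * y.1 + x.2 * y.2)) := by
    apply StronglyMeasurable.integral_prod_right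
    apply Continuous.stronglyMeasurable
    unfold Function.uncurry
    fun_prop
  unfold suppFn
  exact ((h.measurable.div_const _).log).const_mul _

lemma suppFn_image_sub {p : ℝ} (hp : 0 < p) {K : Set (ℝ × ℝ)} (hK : IsCompact K)
    (hne : (interior K).Nonempty) (v y : ℝ × ℝ) :
    suppFn p ((fun q => q - v) '' K) y = suppFn p K y - (v.1 * y.1 + v.2 * y.2) := by
  have hmp := measurePreserving_sub_right (volume : Measure (ℝ × ℝ)) v
  have hvol : volume ((fun q => q - v) '' K) = volume K := by
    rw [← hmp.measure_preimage_emb (measurableEmbedding_subRight v),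
      preimage_image_eq _ (sub_left_injective)]
  have hint : ∫ x in (fun q => q - v) '' K, Real.exp (p * (x.1 * y.1 + x.2 * y.2)) =
      Real.exp (-(p * (v.1 * y.1 + v.2 * y.2))) *
        ∫ x in K, Real.exp (p * (x.1 * y.1 + x.2 * y.2)) := by
    rw [hmp.setIntegral_image_emb (measurableEmbedding_subRight v), ← integral_const_mul]
    congr 1
    ext x
    rw [← Real.exp_add]
    congr 1
    simp only [Prod.fst_sub, Prod.snd_sub]
    ring
  unfold suppFn
  rw [hvol, hint, mul_div_assoc, Real.log_mul (Real.exp_ne_zero _)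
    (div_pos (setIntegral_exp_dot_pos p hK hne y) (toReal_volume_pos hK hne)).ne', Real.log_exp]
  field_simp
  ring

lemma suppFn_le {p : ℝ} (hp : 0 < p) {K : Set (ℝ × ℝ)} (hK : IsCompact K)
    (hne : (interior K).Nonempty) {y : ℝ × ℝ} {m : ℝ}
    (hm : ∀ x ∈ K, x.1 * y.1 + x.2 * y.2 ≤ m) : suppFn p K y ≤ m := by
  have hV := toReal_volume_pos hK hne
  have hle : ∫ x in K, Real.exp (p * (x.1 * y.1 + x.2 * y.2)) ≤
      Real.exp (p * m) * (volume K).toReal := by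
    calc _ ≤ ∫ x in K, Real.exp (p * m) := by
          refine setIntegral_mono_on (integrableOn_exp_dot p hK y)
            (integrableOn_const hK.measure_lt_top.ne) hK.measurableSet fun x hx => ?_
          exact Real.exp_le_exp.2 (mul_le_mul_of_nonneg_left (hm x hx) hp.le)
      _ = _ := by simp [Measure.real, mul_comm]
  have hlog : Real.log ((∫ x in K, Real.exp (p * (x.1 * y.1 + x.2 * y.2))) / (volume K).toReal) ≤
      p * m := by
    rw [Real.log_le_iff_le_exp (div_pos (setIntegral_exp_dot_pos p hK hne y) hV), div_le_iff₀ hV]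
    exact hle
  unfold suppFn
  rw [one_div, inv_mul_le_iff₀ hp]
  exact hlog

lemma exists_exp_neg_suppFn_le {p : ℝ} (hp : 0 < p) {K : Set (ℝ × ℝ)} (hK : IsCompact K)
    {a : ℝ × ℝ} (ha : a ∈ interior K) :
    ∃ c C : ℝ, 0 < c ∧ 0 < C ∧ ∀ y : ℝ × ℝ,
      Real.exp (-suppFn p K y + (a.1 * y.1 + a.2 * y.2)) ≤
        C * Real.exp (-c * (|y.1| + |y.2|)) := by
  have hne : (interior K).Nonempty := ⟨a, ha⟩
  obtain ⟨ε, hε, hball⟩ := Metric.nhds_basis_closedBall.mem_iff.1 (mem_interior_iff_mem_nhds.1 ha)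
  set c := ε / 4 with hc
  have hc0 : 0 < c := by positivity
  set V := (volume (Metric.closedBall (0 : ℝ × ℝ) c)).toReal with hV
  have hV0 : 0 < V := ENNReal.toReal_pos
    (Metric.measure_closedBall_pos _ _ hc0).ne' measure_closedBall_lt_top.ne
  have hW := toReal_volume_pos hK hne
  refine ⟨c, Real.exp (-(1 / p * Real.log (V / (volume K).toReal))), hc0, Real.exp_pos _,
    fun y => ?_⟩
  obtain ⟨s₁, hs₁, hsy₁⟩ : ∃ s : ℝ, |s| = 1 ∧ s * y.1 = |y.1| := by
    rcases le_total 0 y.1 with h | h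
    · exact ⟨1, by simp, by simp [abs_of_nonneg h]⟩
    · exact ⟨-1, by simp, by simp [abs_of_nonpos h]⟩
  obtain ⟨s₂, hs₂, hsy₂⟩ : ∃ s : ℝ, |s| = 1 ∧ s * y.2 = |y.2| := by
    rcases le_total 0 y.2 with h | h
    · exact ⟨1, by simp, by simp [abs_of_nonneg h]⟩
    · exact ⟨-1, by simp, by simp [abs_of_nonpos h]⟩
  set q : ℝ × ℝ := a + (2 * c) • (s₁, s₂) with hq
  have hsub : Metric.closedBall q c ⊆ K := by
    refine Subset.trans (Metric.closedBall_subset_closedBall' ?_) hball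
    have : dist q a = 2 * c := by
      rw [dist_eq_norm, hq, add_sub_cancel_left, norm_smul, Prod.norm_def]
      simp [hs₁, hs₂, abs_of_pos hc0]
    rw [this, hc]
    linarith
  have hlow : Real.exp (p * (a.1 * y.1 + a.2 * y.2 + c * (|y.1| + |y.2|))) * V ≤
      ∫ x in K, Real.exp (p * (x.1 * y.1 + x.2 * y.2)) := by
    calc _ = ∫ x in Metric.closedBall q c,
          Real.exp (p * (a.1 * y.1 + a.2 * y.2 + c * (|y.1| + |y.2|))) := by
          rw [setIntegral_const, Measure.real, Measure.addHaar_closedBall_center, smul_eq_mul,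
            mul_comm]
      _ ≤ ∫ x in Metric.closedBall q c, Real.exp (p * (x.1 * y.1 + x.2 * y.2)) := by
          refine setIntegral_mono_on (integrableOn_const measure_closedBall_lt_top.ne)
            (integrableOn_exp_dot p (isCompact_closedBall _ _) y) measurableSet_closedBall
            fun x hx => ?_
          rw [Metric.mem_closedBall, dist_eq_norm, Prod.norm_def, max_le_iff] at hx
          obtain ⟨h1, h2⟩ := hx
          rw [Real.norm_eq_abs] at h1 h2
          refine Real.exp_le_exp.2 (mul_le_mul_of_nonneg_left ?_ hp.le)
          have e1 : q.1 = a.1 + 2 * c * s₁ := by simp [hq]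
          have e2 : q.2 = a.2 + 2 * c * s₂ := by simp [hq]
          have h1' : -(c * |y.1|) ≤ (x.1 - q.1) * y.1 := by
            refine neg_le_of_abs_le ?_
            rw [abs_mul]
            exact mul_le_mul_of_nonneg_right h1 (abs_nonneg _)
          have h2' : -(c * |y.2|) ≤ (x.2 - q.2) * y.2 := by
            refine neg_le_of_abs_le ?_
            rw [abs_mul]
            exact mul_le_mul_of_nonneg_right h2 (abs_nonneg _)
          rw [e1] at h1'
          rw [e2] at h2'
          linear_combination h1' + h2' - 2 * c * hsy₁ - 2 * c * hsy₂
      _ ≤ _ := setIntegral_mono_set (integrableOn_exp_dot p hK y)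
          (Filter.Eventually.of_forall fun x => (Real.exp_pos _).le) hsub.eventuallyLE
  have hlog : p * (a.1 * y.1 + a.2 * y.2 + c * (|y.1| + |y.2|)) +
      Real.log (V / (volume K).toReal) ≤
      Real.log ((∫ x in K, Real.exp (p * (x.1 * y.1 + x.2 * y.2))) / (volume K).toReal) := by
    rw [← Real.log_exp (p * (a.1 * y.1 + a.2 * y.2 + c * (|y.1| + |y.2|))),
      ← Real.log_mul (Real.exp_ne_zero _) (div_pos hV0 hW).ne', ← mul_div_assoc]
    exact Real.log_le_log (by positivity) (div_le_div_of_nonneg_right hlow hW.le)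
  rw [← Real.exp_add]
  refine Real.exp_le_exp.2 ?_
  have := mul_le_mul_of_nonneg_left hlog (one_div_pos.2 hp).le
  have e : 1 / p * (p * (a.1 * y.1 + a.2 * y.2 + c * (|y.1| + |y.2|)) +
      Real.log (V / (volume K).toReal)) = a.1 * y.1 + a.2 * y.2 + c * (|y.1| + |y.2|) +
      1 / p * Real.log (V / (volume K).toReal) := by field_simp
  rw [e] at this
  unfold suppFn
  linarith

lemma integrable_exp_neg_mul_abs {c : ℝ} (hc : 0 < c) :
    Integrable fun x : ℝ => Real.exp (-c * |x|) := by
  have h1 : IntegrableOn (fun x : ℝ => Real.exp (-c * |x|)) (Ioi 0) :=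
    (integrableOn_exp_mul_Ioi (a := -c) (by linarith) 0).congr_fun
      (fun x hx => by simp only [abs_of_pos (mem_Ioi.1 hx)]) measurableSet_Ioi
  have h2 : IntegrableOn (fun x : ℝ => Real.exp (-c * |x|)) (Iic 0) :=
    (integrableOn_exp_mul_Iic (a := c) hc 0).congr_fun
      (fun x hx => by simp only [abs_of_nonpos (mem_Iic.1 hx)]; ring_nf) measurableSet_Iic
  rw [← integrableOn_univ, ← Iic_union_Ioi (a := (0 : ℝ))]
  exact h2.union h1

lemma lintegral_exp_neg_suppFn_lt_top {p : ℝ} (hp : 0 < p) {K : Set (ℝ × ℝ)} (hK : IsCompact K)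
    {a : ℝ × ℝ} (ha : a ∈ interior K) :
    ∫⁻ y : ℝ × ℝ, ENNReal.ofReal (Real.exp (-suppFn p K y + (a.1 * y.1 + a.2 * y.2))) < ⊤ := by
  obtain ⟨c, C, hc, hC, h⟩ := exists_exp_neg_suppFn_le hp hK ha
  have hi : Integrable fun y : ℝ × ℝ => C * Real.exp (-c * (|y.1| + |y.2|)) := by
    have := ((integrable_exp_neg_mul_abs hc).mul_prod (integrable_exp_neg_mul_abs hc)).const_mul C
    refine this.congr (Filter.Eventually.of_forall fun y => ?_)
    simp only
    rw [← Real.exp_add]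
    ring_nf
  exact (lintegral_mono fun y => ENNReal.ofReal_le_ofReal (h y)).trans_lt hi.lintegral_lt_top

lemma lintegral_eq_of_radial_eq {f g : ℝ × ℝ → ENNReal} (hf : Measurable f) (hg : Measurable g)
    (h : ∀ e : ℝ × ℝ, e ≠ 0 → ∫⁻ r in Ioi (0 : ℝ), ENNReal.ofReal r * f (r • e) =
      ∫⁻ r in Ioi (0 : ℝ), ENNReal.ofReal r * g (r • e)) :
    ∫⁻ y, f y = ∫⁻ y, g y := by
  have key : ∀ u : ℝ × ℝ → ENNReal, Measurable u → ∫⁻ y, u y =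
      ∫⁻ θ in Ioo (-Real.pi) Real.pi, ∫⁻ r in Ioi (0 : ℝ),
        ENNReal.ofReal r * u (r • (Real.cos θ, Real.sin θ)) := by
    intro u hu
    rw [← lintegral_comp_polarCoord_symm, polarCoord_target, Measure.volume_eq_prod,
      ← Measure.prod_restrict, lintegral_prod_symm]
    · simp [polarCoord_symm_apply]
    · apply Measurable.aemeasurable
      simp only [polarCoord_symm_apply, smul_eq_mul]
      fun_prop
  rw [key f hf, key g hg]
  refine lintegral_congr fun θ => h _ fun h0 => ?_
  have h1 : Real.cos θ = 0 := congrArg Prod.fst h0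
  have h2 : Real.sin θ = 0 := congrArg Prod.snd h0
  have := Real.sin_sq_add_cos_sq θ
  rw [h1, h2] at this
  norm_num at this

lemma integrableOn_mul_exp_neg_suppFn {p : ℝ} (hp : 0 < p) {K : Set (ℝ × ℝ)} (hK : IsCompact K)
    (h0 : (0 : ℝ × ℝ) ∈ interior K) {e : ℝ × ℝ} (he : e ≠ 0) :
    IntegrableOn (fun r : ℝ => r * Real.exp (-(suppFn p K (r • e)))) (Ioi 0) := by
  obtain ⟨c, C, hc, hC, h⟩ := exists_exp_neg_suppFn_le hp hK h0
  have hE : 0 < |e.1| + |e.2| := by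
    by_contra hcon
    have h1 := abs_nonneg e.1
    have h2 := abs_nonneg e.2
    exact he (Prod.ext (abs_eq_zero.1 (by linarith)) (abs_eq_zero.1 (by linarith)))
  have hi := (integrableOn_rpow_mul_exp_neg_mul_rpow (s := 1) (p := 1) (by norm_num) one_pos
    (mul_pos hc hE)).const_mul C
  refine hi.mono' ?_ ?_
  · have := measurable_suppFn p K
    apply Measurable.aestronglyMeasurable
    fun_prop
  · filter_upwards [ae_restrict_mem measurableSet_Ioi] with r hr
    have hr : 0 < r := hr
    have hh := h (r • e)
    simp only [Prod.fst_zero, Prod.snd_zero, zero_mul, add_zero, Prod.smul_fst, Prod.smul_snd,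
      smul_eq_mul, abs_mul, abs_of_pos hr] at hh
    rw [Real.norm_eq_abs, abs_of_nonneg (mul_nonneg hr.le (Real.exp_pos _).le), Real.rpow_one]
    calc _ ≤ r * (C * Real.exp (-c * (r * |e.1| + r * |e.2|))) :=
          mul_le_mul_of_nonneg_left hh hr.le
      _ = _ := by ring_nf

lemma setIntegral_mul_exp_neg_suppFn_pos {p : ℝ} (hp : 0 < p) {K : Set (ℝ × ℝ)}
    (hK : IsCompact K) (h0 : (0 : ℝ × ℝ) ∈ interior K) {e : ℝ × ℝ} (he : e ≠ 0) :
    0 < ∫ r in Ioi (0 : ℝ), r * Real.exp (-(suppFn p K (r • e))) := by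
  rw [setIntegral_pos_iff_support_of_nonneg_ae _ (integrableOn_mul_exp_neg_suppFn hp hK h0 he)]
  · refine lt_of_lt_of_le ?_ (measure_mono (s := Ioi (0 : ℝ)) fun r hr => ⟨?_, hr⟩)
    · simp
    · exact (mul_pos hr (Real.exp_pos _)).ne'
  · filter_upwards [ae_restrict_mem measurableSet_Ioi] with r hr
    exact (mul_pos hr (Real.exp_pos _)).le

lemma setIntegral_mul_exp_neg_suppFn_smul (p : ℝ) (K : Set (ℝ × ℝ)) (e : ℝ × ℝ) {s : ℝ}
    (hs : 0 < s) :
    ∫ r in Ioi (0 : ℝ), r * Real.exp (-(suppFn p K (r • s • e))) =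
      (∫ r in Ioi (0 : ℝ), r * Real.exp (-(suppFn p K (r • e)))) / s ^ 2 := by
  have := integral_comp_mul_right_Ioi
    (fun r : ℝ => r * Real.exp (-(suppFn p K (r • e)))) 0 hs
  rw [zero_mul, smul_eq_mul] at this
  have e2 : ∫ r in Ioi (0 : ℝ), r * s * Real.exp (-(suppFn p K ((r * s) • e))) =
      s * ∫ r in Ioi (0 : ℝ), r * Real.exp (-(suppFn p K (r • s • e))) := by
    rw [← integral_const_mul]
    congr 1
    ext r
    rw [smul_smul]
    ring
  rw [e2] at this
  field_simp at this ⊢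
  linarith

lemma nearNorm_le_one_iff {p : ℝ} (hp : 0 < p) {K : Set (ℝ × ℝ)}
    (hK : IsCompact K) (h0 : (0 : ℝ × ℝ) ∈ interior K) {y : ℝ × ℝ} (hy : y ≠ 0) :
    nearNorm p K y ≤ 1 ↔ 1 ≤ ∫ r in Ioi (0 : ℝ), r * Real.exp (-(suppFn p K (r • y))) := by
  rw [nearNorm, if_neg hy,
    Real.rpow_le_one_iff_of_pos (setIntegral_mul_exp_neg_suppFn_pos hp hK h0 hy)]
  norm_num

lemma measurableSet_lpPolar (p : ℝ) (K : Set (ℝ × ℝ)) : MeasurableSet (lpPolar p K) := by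
  have h : StronglyMeasurable fun y : ℝ × ℝ =>
      ∫ r in Ioi (0 : ℝ), r * Real.exp (-(suppFn p K (r • y))) := by
    apply StronglyMeasurable.integral_prod_right
    apply Measurable.stronglyMeasurable
    have := measurable_suppFn p K
    unfold Function.uncurry
    fun_prop
  refine measurableSet_le (Measurable.ite (measurableSet_singleton 0) measurable_const ?_)
    measurable_const
  exact h.measurable.pow_const _

lemma volume_lpPolar_inter {p : ℝ} (hp : 0 < p) {K : Set (ℝ × ℝ)}
    (hK : IsCompact K) (h0 : (0 : ℝ × ℝ) ∈ interior K) {S : Set (ℝ × ℝ)} (hS : MeasurableSet S)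
    (hcone : ∀ r : ℝ, 0 < r → ∀ y : ℝ × ℝ, r • y ∈ S ↔ y ∈ S) :
    volume (lpPolar p K ∩ S) =
      ENNReal.ofReal (1 / 2) * ∫⁻ y in S, ENNReal.ofReal (Real.exp (-suppFn p K y)) := by
  have hA := measurableSet_lpPolar p K
  have hm : Measurable fun y => ENNReal.ofReal (Real.exp (-suppFn p K y)) := by
    have := measurable_suppFn p K
    fun_prop
  rw [← lintegral_indicator hS, ← lintegral_const_mul _ (hm.indicator hS),
    ← lintegral_indicator_one (hA.inter hS)]
  refine lintegral_eq_of_radial_eq (measurable_one.indicator (hA.inter hS))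
    ((hm.indicator hS).const_mul _) fun e he => ?_
  by_cases heS : e ∈ S
  swap
  · have h1 : ∀ r ∈ Ioi (0 : ℝ), r • e ∉ S := fun r hr => by rwa [hcone r hr]
    refine setLIntegral_congr_fun measurableSet_Ioi fun r hr => ?_
    simp [h1 r hr]
  set ρ := ∫ r in Ioi (0 : ℝ), r * Real.exp (-(suppFn p K (r • e))) with hρ
  have hρ0 : 0 < ρ := setIntegral_mul_exp_neg_suppFn_pos hp hK h0 he
  have hmem : ∀ r ∈ Ioi (0 : ℝ), (r • e ∈ lpPolar p K ∩ S ↔ r ≤ √ρ) := by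
    intro r hr
    have hr : 0 < r := hr
    rw [mem_inter_iff, hcone r hr, and_iff_left heS, lpPolar, mem_ofPred_eq,
      nearNorm_le_one_iff hp hK h0 (smul_ne_zero hr.ne' he),
      setIntegral_mul_exp_neg_suppFn_smul p K e hr, one_le_div (by positivity),
      ← hρ, Real.le_sqrt' hr]
  have hleft : ∫⁻ r in Ioi (0 : ℝ), ENNReal.ofReal r *
      (lpPolar p K ∩ S).indicator 1 (r • e) = ENNReal.ofReal (ρ / 2) := by
    rw [setLIntegral_congr_fun (g := (Iic √ρ).indicator fun r => ENNReal.ofReal r)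
      measurableSet_Ioi fun r hr => ?_]
    · rw [setLIntegral_indicator measurableSet_Iic, Iic_inter_Ioi,
        ← ofReal_integral_eq_lintegral_ofReal,
        ← intervalIntegral.integral_of_le (Real.sqrt_nonneg _),
        integral_id, Real.sq_sqrt hρ0.le]
      · norm_num
      · exact (continuous_id.integrableOn_Icc).mono_set Ioc_subset_Icc_self
      · filter_upwards [ae_restrict_mem measurableSet_Ioc] with r hr
        exact hr.1.le
    · by_cases h : r ≤ √ρ
      · simp [indicator_of_mem ((hmem r hr).2 h), h]
      · rw [indicator_of_notMem (fun h' => h ((hmem r hr).1 h')),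
          indicator_of_notMem (by simpa using h), mul_zero]
  have hright : ∫⁻ r in Ioi (0 : ℝ), ENNReal.ofReal r * (ENNReal.ofReal (1 / 2) *
      S.indicator (fun y => ENNReal.ofReal (Real.exp (-suppFn p K y))) (r • e)) =
      ENNReal.ofReal (ρ / 2) := by
    rw [setLIntegral_congr_fun (g := fun r => ENNReal.ofReal (1 / 2) *
      ENNReal.ofReal (r * Real.exp (-(suppFn p K (r • e))))) measurableSet_Ioi fun r hr => ?_]
    · rw [lintegral_const_mul' _ _ ENNReal.ofReal_ne_top, ← ofReal_integral_eq_lintegral_ofReal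
        (integrableOn_mul_exp_neg_suppFn hp hK h0 he), ← ENNReal.ofReal_mul (by norm_num)]
      · congr 1
        ring
      · filter_upwards [ae_restrict_mem measurableSet_Ioi] with r hr
        exact (mul_pos hr (Real.exp_pos _)).le
    · simp only
      rw [indicator_of_mem ((hcone r hr e).2 heS), ENNReal.ofReal_mul (le_of_lt hr)]
      ring
  rw [hleft, hright]

/-- The integral of `exp (-h + s σ y₁)` over the half-plane `0 < σ y₁`, where `h` is the
`L^p`-support function of `K`. -/
noncomputable def halfIntegral (p : ℝ) (K : Set (ℝ × ℝ)) (σ s : ℝ) : ENNReal :=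
  ∫⁻ y in {y : ℝ × ℝ | 0 < σ * y.1},
    ENNReal.ofReal (Real.exp (-suppFn p K y + σ * s * y.1))

lemma measurableSet_halfPlane (σ : ℝ) : MeasurableSet {y : ℝ × ℝ | 0 < σ * y.1} :=
  measurableSet_lt measurable_const (by fun_prop)

lemma measurable_ofReal_exp_neg_suppFn_add (p : ℝ) (K : Set (ℝ × ℝ)) (c : ℝ) :
    Measurable fun y : ℝ × ℝ => ENNReal.ofReal (Real.exp (-suppFn p K y + c * y.1)) := by
  have := measurable_suppFn p K
  fun_prop

lemma volume_lpPolar_image_sub_inter {p : ℝ} (hp : 0 < p) {K : Set (ℝ × ℝ)} (hK : IsCompact K)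
    {x : ℝ} (hx : (x, (0 : ℝ)) ∈ interior K) {σ : ℝ} (hσ : σ * σ = 1) :
    volume (lpPolar p ((fun q => q - (x, (0 : ℝ))) '' K) ∩ {y : ℝ × ℝ | 0 < σ * y.1}) =
      ENNReal.ofReal (1 / 2) * halfIntegral p K σ (σ * x) := by
  have h0 : (0 : ℝ × ℝ) ∈ interior ((fun q => q - (x, (0 : ℝ))) '' K) := by
    have := (Homeomorph.subRight ((x, (0 : ℝ)) : ℝ × ℝ)).image_interior K
    rw [show (fun q => q - (x, (0 : ℝ))) = ⇑(Homeomorph.subRight ((x, (0 : ℝ)) : ℝ × ℝ)) from rfl,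
      ← this]
    exact ⟨_, hx, by simp⟩
  rw [volume_lpPolar_inter hp (hK.image (by fun_prop)) h0 (measurableSet_halfPlane σ)]
  · unfold halfIntegral
    congr 2
    ext y
    rw [suppFn_image_sub hp hK ⟨_, hx⟩]
    congr 2
    linear_combination (-(x * y.1)) * hσ
  · intro r hr y
    simp only [mem_ofPred_eq, Prod.smul_fst, smul_eq_mul]
    rw [mul_left_comm, mul_pos_iff_of_pos_left hr]

lemma halfIntegral_lt_top {p : ℝ} (hp : 0 < p) {K : Set (ℝ × ℝ)} (hK : IsCompact K)
    {σ s : ℝ} (hs : (σ * s, (0 : ℝ)) ∈ interior K) : halfIntegral p K σ s < ⊤ := by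
  have := lintegral_exp_neg_suppFn_lt_top hp hK hs
  simp only [zero_mul, add_zero] at this
  exact (setLIntegral_le_lintegral _ _).trans_lt this

lemma halfIntegral_mono (p : ℝ) (K : Set (ℝ × ℝ)) (σ : ℝ) : Monotone (halfIntegral p K σ) := by
  intro s t hst
  refine setLIntegral_mono (measurable_ofReal_exp_neg_suppFn_add p K _) fun y hy => ?_
  refine ENNReal.ofReal_le_ofReal (Real.exp_le_exp.2 ?_)
  have : 0 < σ * y.1 := hy
  nlinarith

lemma halfIntegral_pos (p : ℝ) (K : Set (ℝ × ℝ)) {σ : ℝ} (hσ : σ * σ = 1) (s : ℝ) :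
    0 < halfIntegral p K σ s := by
  unfold halfIntegral
  rw [setLIntegral_pos_iff (measurable_ofReal_exp_neg_suppFn_add p K _)]
  have : Function.support (fun y : ℝ × ℝ =>
      ENNReal.ofReal (Real.exp (-suppFn p K y + σ * s * y.1))) = univ := by
    ext y; simp [Real.exp_pos]
  rw [this, univ_inter]
  refine IsOpen.measure_pos volume (isOpen_lt continuous_const (by fun_prop)) ⟨(σ, 0), ?_⟩
  simp [hσ]

lemma continuousAt_halfIntegral {p : ℝ} (hp : 0 < p) {K : Set (ℝ × ℝ)} (hK : IsCompact K)
    {σ s : ℝ} (hs : (σ * s, (0 : ℝ)) ∈ interior K) : ContinuousAt (halfIntegral p K σ) s := by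
  obtain ⟨b, hsb, hb⟩ : ∃ b, s < b ∧ (σ * b, (0 : ℝ)) ∈ interior K := by
    have hc : ContinuousAt (fun u : ℝ => (σ * u, (0 : ℝ))) s := by fun_prop
    have hn : ∀ᶠ u in nhds s, (σ * u, (0 : ℝ)) ∈ interior K :=
      hc.eventually_mem (isOpen_interior.mem_nhds hs)
    obtain ⟨b, hb⟩ := ((hn.filter_mono nhdsWithin_le_nhds).and
      (self_mem_nhdsWithin (s := Ioi s))).exists
    exact ⟨b, hb.2, hb.1⟩
  refine tendsto_lintegral_filter_of_dominated_convergence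
    (fun y => ENNReal.ofReal (Real.exp (-suppFn p K y + σ * b * y.1))) ?_ ?_
    (halfIntegral_lt_top hp hK hb).ne ?_
  · exact Filter.Eventually.of_forall fun u => measurable_ofReal_exp_neg_suppFn_add p K _
  · filter_upwards [Iio_mem_nhds hsb] with u hu
    filter_upwards [ae_restrict_mem (measurableSet_halfPlane σ)] with y hy
    refine ENNReal.ofReal_le_ofReal (Real.exp_le_exp.2 ?_)
    have h1 : 0 < σ * y.1 := hy
    have h2 : u < b := hu
    nlinarith
  · refine Filter.Eventually.of_forall fun y => ?_
    have : Continuous fun u : ℝ => ENNReal.ofReal (Real.exp (-suppFn p K y + σ * u * y.1)) :=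
      ENNReal.continuous_ofReal.comp (by fun_prop)
    exact this.tendsto s

lemma exists_supporting_covector {K : Set (ℝ × ℝ)} (hKc : Convex ℝ K) {u : ℝ × ℝ}
    (h0 : (0 : ℝ × ℝ) ∈ interior K) (hu : u ∉ interior K) :
    ∃ a b : ℝ, 0 < a * u.1 + b * u.2 ∧ ∀ x ∈ K, a * x.1 + b * x.2 ≤ a * u.1 + b * u.2 := by
  obtain ⟨f, hf⟩ := geometric_hahn_banach_open_point hKc.interior isOpen_interior hu
  have hrep : ∀ x : ℝ × ℝ, f x = f (1, 0) * x.1 + f (0, 1) * x.2 := by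
    intro x
    have : x = x.1 • ((1, 0) : ℝ × ℝ) + x.2 • ((0, 1) : ℝ × ℝ) := by ext <;> simp
    conv_lhs => rw [this]
    rw [map_add, map_smul, map_smul, smul_eq_mul, smul_eq_mul]
    ring
  refine ⟨f (1, 0), f (0, 1), ?_, fun x hx => ?_⟩
  · rw [← hrep]
    simpa using hf 0 h0
  · rw [← hrep, ← hrep]
    have hx' : x ∈ closure (interior K) := by
      rw [hKc.closure_interior_eq_closure_of_nonempty_interior ⟨_, h0⟩]
      exact subset_closure hx
    exact closure_minimal (t := {x | f x ≤ f u}) (fun z hz => (hf z hz).le)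
      (isClosed_le f.continuous continuous_const) hx'

lemma volume_strip_eq_top {σ : ℝ} (hσ : σ = 1 ∨ σ = -1) (k : ℝ) :
    volume {y : ℝ × ℝ | 0 < σ * y.1 ∧ |y.2 - k * y.1| ≤ 1} = ⊤ := by
  have hm : MeasurableSet {y : ℝ × ℝ | 0 < σ * y.1 ∧ |y.2 - k * y.1| ≤ 1} :=
    (measurableSet_halfPlane σ).inter (measurableSet_le
      (f := fun y : ℝ × ℝ => |y.2 - k * y.1|) (by fun_prop) measurable_const)
  have hH : MeasurableSet {a : ℝ | 0 < σ * a} := measurableSet_lt measurable_const (by fun_prop)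
  have hv : volume {a : ℝ | 0 < σ * a} = ⊤ := by
    rcases hσ with rfl | rfl
    · simp only [one_mul]
      exact Real.volume_Ioi
    · simp only [neg_mul, one_mul, Left.neg_pos_iff]
      exact Real.volume_Iio
  rw [Measure.volume_eq_prod, Measure.prod_apply hm, eq_top_iff]
  calc (⊤ : ENNReal) = ∫⁻ a in {a : ℝ | 0 < σ * a}, 2 := by
        rw [setLIntegral_const, hv, ENNReal.mul_top (by norm_num)]
    _ ≤ ∫⁻ a in {a : ℝ | 0 < σ * a},
          volume (Prod.mk a ⁻¹' {y : ℝ × ℝ | 0 < σ * y.1 ∧ |y.2 - k * y.1| ≤ 1}) := by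
        refine setLIntegral_mono (measurable_measure_prodMk_left hm) fun a ha => ?_
        have : Icc (k * a - 1) (k * a + 1) ⊆
            Prod.mk a ⁻¹' {y : ℝ × ℝ | 0 < σ * y.1 ∧ |y.2 - k * y.1| ≤ 1} := by
          intro z hz
          refine ⟨ha, abs_le.2 ⟨?_, ?_⟩⟩
          · simp only; linarith [hz.1]
          · simp only; linarith [hz.2]
        refine le_trans ?_ (measure_mono this)
        rw [Real.volume_Icc]
        norm_num
    _ ≤ _ := setLIntegral_le_lintegral _ _

lemma halfIntegral_eq_top {p : ℝ} (hp : 0 < p) {K : Set (ℝ × ℝ)} (hK : IsCompact K)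
    (hKc : Convex ℝ K) (h0 : (0 : ℝ × ℝ) ∈ interior K) {σ : ℝ} (hσ : σ = 1 ∨ σ = -1) {s : ℝ}
    (hs : 0 < s) (hsK : (σ * s, (0 : ℝ)) ∉ interior K) : halfIntegral p K σ s = ⊤ := by
  obtain ⟨a, b, hpos, hab⟩ := exists_supporting_covector hKc h0 hsK
  simp only [mul_zero, add_zero] at hpos hab
  have hσ2 : σ * σ = 1 := by rcases hσ with rfl | rfl <;> norm_num
  have haσ : 0 < σ * a := by
    have : 0 < s * (σ * a) := by linarith
    exact (mul_pos_iff_of_pos_left hs).1 this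
  have ha : a ≠ 0 := by rintro rfl; simp at haσ
  obtain ⟨M, hM⟩ := hK.exists_bound_of_continuousOn (f := fun x : ℝ × ℝ => x.2) (by fun_prop)
  have hM0 : 0 ≤ M := (norm_nonneg _).trans (hM 0 (interior_subset h0))
  have hbound : ∀ y ∈ {y : ℝ × ℝ | 0 < σ * y.1 ∧ |y.2 - b / a * y.1| ≤ 1},
      -M ≤ -suppFn p K y + σ * s * y.1 := by
    rintro y ⟨hy1, hy2⟩
    have ht : 0 ≤ y.1 / a := by
      have : y.1 / a = (σ * y.1) / (σ * a) := by
        rw [mul_div_mul_left]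
        rintro rfl
        simp at hσ2
      rw [this]
      positivity
    have : suppFn p K y ≤ σ * s * y.1 + M := by
      refine suppFn_le hp hK ⟨_, h0⟩ fun x hx => ?_
      have h1 := mul_le_mul_of_nonneg_left (hab x hx) ht
      have h2 : x.2 * (y.2 - b / a * y.1) ≤ M := by
        refine (le_abs_self _).trans ?_
        rw [abs_mul]
        have := mul_le_mul (hM x hx) hy2 (abs_nonneg _) hM0
        simpa using this
      have e1 : y.1 / a * (a * x.1 + b * x.2) + x.2 * (y.2 - b / a * y.1) =
          x.1 * y.1 + x.2 * y.2 := by field_simp; ring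
      have e2 : y.1 / a * (a * (σ * s)) = σ * s * y.1 := by field_simp
      linarith
    linarith
  rw [eq_top_iff]
  calc (⊤ : ENNReal)
      = ∫⁻ y in {y : ℝ × ℝ | 0 < σ * y.1 ∧ |y.2 - b / a * y.1| ≤ 1},
          ENNReal.ofReal (Real.exp (-M)) := by
        rw [setLIntegral_const, volume_strip_eq_top hσ, ENNReal.mul_top]
        simp [Real.exp_pos]
    _ ≤ ∫⁻ y in {y : ℝ × ℝ | 0 < σ * y.1 ∧ |y.2 - b / a * y.1| ≤ 1},
          ENNReal.ofReal (Real.exp (-suppFn p K y + σ * s * y.1)) :=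
        setLIntegral_mono (measurable_ofReal_exp_neg_suppFn_add p K _) fun y hy =>
          ENNReal.ofReal_le_ofReal (Real.exp_le_exp.2 (hbound y hy))
    _ ≤ _ := lintegral_mono_set fun y hy => hy.1

lemma exists_lt_halfIntegral {p : ℝ} {K : Set (ℝ × ℝ)} {σ β : ℝ} (hβ : 0 < β)
    (htop : halfIntegral p K σ β = ⊤) {M : ENNReal} (hM : M < ⊤) :
    ∃ s, 0 ≤ s ∧ s < β ∧ M < halfIntegral p K σ s := by
  obtain ⟨u, hu, hmem, hlim⟩ := exists_seq_strictMono_tendsto' hβ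
  have := lintegral_tendsto_of_tendsto_of_monotone
    (μ := volume.restrict {y : ℝ × ℝ | 0 < σ * y.1})
    (f := fun n y => ENNReal.ofReal (Real.exp (-suppFn p K y + σ * u n * y.1)))
    (F := fun y => ENNReal.ofReal (Real.exp (-suppFn p K y + σ * β * y.1)))
    (fun n => (measurable_ofReal_exp_neg_suppFn_add p K _).aemeasurable) ?_ ?_
  · obtain ⟨n, hn⟩ := (this.eventually_const_lt (hM.trans_eq htop.symm)).exists
    exact ⟨u n, (hmem n).1.le, (hmem n).2, hn⟩
  · filter_upwards [ae_restrict_mem (measurableSet_halfPlane σ)] with y hy m n hmn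
    refine ENNReal.ofReal_le_ofReal (Real.exp_le_exp.2 ?_)
    have h1 : 0 < σ * y.1 := hy
    have h2 : u m ≤ u n := hu.monotone hmn
    nlinarith
  · refine Filter.Eventually.of_forall fun y => ?_
    have hc : Continuous fun v : ℝ => ENNReal.ofReal (Real.exp (-suppFn p K y + σ * v * y.1)) :=
      ENNReal.continuous_ofReal.comp (by fun_prop)
    exact (hc.tendsto β).comp hlim

/-- If `K` and `L` have `0` in their interiors, the product of the right half-integral of `K` and
the left half-integral of `L` becomes arbitrarily large before `(s, 0)` leaves `interior K` or
`(-s, 0)` leaves `interior L`. -/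
lemma exists_le_halfIntegral_mul {p : ℝ} (hp : 0 < p) {K L : Set (ℝ × ℝ)}
    (hK : IsCompact K) (hKc : Convex ℝ K) (hK0 : (0 : ℝ × ℝ) ∈ interior K)
    (hL : IsCompact L) (hLc : Convex ℝ L) (hL0 : (0 : ℝ × ℝ) ∈ interior L)
    {σ : ℝ} (hσ : σ = 1 ∨ σ = -1) {M : ENNReal} (hM : M < ⊤) :
    ∃ s, 0 ≤ s ∧ (σ * s, (0 : ℝ)) ∈ interior K ∧ (-σ * s, (0 : ℝ)) ∈ interior L ∧
      M ≤ halfIntegral p K σ s * halfIntegral p L (-σ) s := by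
  have hσ' : -σ = 1 ∨ -σ = -1 := by rcases hσ with rfl | rfl <;> simp
  have hσ2 : σ * σ = 1 := by rcases hσ with rfl | rfl <;> norm_num
  have hσ2' : -σ * -σ = 1 := by rw [neg_mul_neg, hσ2]
  set D : Set ℝ := {s | (σ * s, (0 : ℝ)) ∈ interior K ∧ (-σ * s, (0 : ℝ)) ∈ interior L}
  have hDopen : IsOpen D :=
    (isOpen_interior.preimage (f := fun s : ℝ => (σ * s, (0 : ℝ))) (by fun_prop)).inter
      (isOpen_interior.preimage (f := fun s : ℝ => (-σ * s, (0 : ℝ))) (by fun_prop))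
  have h0D : (0 : ℝ) ∈ D := by
    refine ⟨?_, ?_⟩ <;> simpa [Prod.mk_zero_zero]
  have hDord : ∀ d ∈ D, ∀ s, 0 ≤ s → s ≤ d → s ∈ D := by
    intro d hd s hs hsd
    rcases hs.eq_or_lt with rfl | hs
    · exact h0D
    have hd0 : 0 < d := hs.trans_le hsd
    have hq : s / d ∈ Icc (0 : ℝ) 1 := ⟨by positivity, (div_le_one hd0).2 hsd⟩
    have e : ∀ τ : ℝ, (τ * s, (0 : ℝ)) = (s / d) • (τ * d, (0 : ℝ)) := by
      intro τ
      ext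
      · simp; field_simp
      · simp
    refine ⟨?_, ?_⟩
    · rw [e]; exact hKc.interior.smul_mem_of_zero_mem hK0 hd.1 hq
    · rw [e]; exact hLc.interior.smul_mem_of_zero_mem hL0 hd.2 hq
  have hDbdd : BddAbove D := by
    obtain ⟨R, hR⟩ := hK.exists_bound_of_continuousOn (f := fun x : ℝ × ℝ => x.1) (by fun_prop)
    refine ⟨R, fun s hs => ?_⟩
    have := hR _ (interior_subset hs.1)
    have hσa : |σ| = 1 := by rcases hσ with rfl | rfl <;> simp
    rw [Real.norm_eq_abs, abs_mul, hσa, one_mul] at this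
    exact (le_abs_self s).trans this
  set β := sSup D
  have hltD : ∀ s, 0 ≤ s → s < β → s ∈ D := by
    intro s hs hsβ
    obtain ⟨d, hd, hsd⟩ := exists_lt_of_lt_csSup ⟨0, h0D⟩ hsβ
    exact hDord d hd s hs hsd.le
  have hexists : ∀ d ∈ D, ∃ d' ∈ D, d < d' := by
    intro d hd
    obtain ⟨d', hd'⟩ := ((Filter.Eventually.filter_mono (nhdsWithin_le_nhds (s := Ioi d))
      (hDopen.eventually_mem hd)).and (self_mem_nhdsWithin (s := Ioi d))).exists
    exact ⟨d', hd'.1, hd'.2⟩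
  have hβ0 : 0 < β := by
    obtain ⟨d, hd, h⟩ := hexists 0 h0D
    exact h.trans_le (le_csSup hDbdd hd)
  have hβD : β ∉ D := fun h => by
    obtain ⟨d, hd, h'⟩ := hexists β h
    exact absurd (le_csSup hDbdd hd) (not_le.2 h')
  have hmain : ∀ {K' L' : Set (ℝ × ℝ)} {τ τ' : ℝ}, IsCompact K' → Convex ℝ K' →
      (0 : ℝ × ℝ) ∈ interior K' → (τ = 1 ∨ τ = -1) → τ' * τ' = 1 →
      (τ * β, (0 : ℝ)) ∉ interior K' →
      ∃ s, 0 ≤ s ∧ s < β ∧ M ≤ halfIntegral p K' τ s * halfIntegral p L' τ' s := by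
    intro K' L' τ τ' hK' hKc' hK0' hτ hτ' hβ'
    have hL0 := halfIntegral_pos p L' hτ' 0
    obtain ⟨s, hs, hsβ, h⟩ := exists_lt_halfIntegral hβ0
      (halfIntegral_eq_top hp hK' hKc' hK0' hτ hβ0 hβ')
      (M := M / halfIntegral p L' τ' 0) (ENNReal.div_lt_top hM.ne hL0.ne')
    refine ⟨s, hs, hsβ, ?_⟩
    refine le_trans ?_ (mul_le_mul_right (halfIntegral_mono p L' τ' hs) _)
    exact (ENNReal.div_le_iff_le_mul (Or.inl hL0.ne') (Or.inr (pos_of_gt h).ne')).1 h.le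
  have hcase : (σ * β, (0 : ℝ)) ∉ interior K ∨ (-σ * β, (0 : ℝ)) ∉ interior L := by
    by_contra! hcon
    exact hβD hcon
  rcases hcase with h | h
  · obtain ⟨s, hs, hsβ, hle⟩ := hmain (L' := L) hK hKc hK0 hσ hσ2' h
    exact ⟨s, hs, (hltD s hs hsβ).1, (hltD s hs hsβ).2, hle⟩
  · obtain ⟨s, hs, hsβ, hle⟩ := hmain (L' := K) hL hLc hL0 hσ' hσ2 h
    exact ⟨s, hs, (hltD s hs hsβ).1, (hltD s hs hsβ).2, by rwa [mul_comm]⟩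

lemma image_add_eq_image_sub_neg (K : Set (ℝ × ℝ)) (x : ℝ) :
    (fun q => q + (x, (0 : ℝ))) '' K = (fun q => q - (-x, (0 : ℝ))) '' K := by
  congr 1
  ext q <;> simp

lemma exists_balanced_halfIntegral {p : ℝ} (hp : 0 < p) {K L : Set (ℝ × ℝ)}
    (hK : IsCompact K) (hKc : Convex ℝ K) (hK0 : (0 : ℝ × ℝ) ∈ interior K)
    (hL : IsCompact L) (hLc : Convex ℝ L) (hL0 : (0 : ℝ × ℝ) ∈ interior L) :
    ∃ x, (x, (0 : ℝ)) ∈ interior K ∧ (-x, (0 : ℝ)) ∈ interior L ∧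
      halfIntegral p K 1 x * halfIntegral p L (-1) x =
        halfIntegral p K (-1) (-x) * halfIntegral p L 1 (-x) := by
  have h0 : ∀ {N : Set (ℝ × ℝ)} {σ : ℝ}, (0 : ℝ × ℝ) ∈ interior N →
      (σ * 0, (0 : ℝ)) ∈ interior N := by
    intro N σ h
    simpa [Prod.mk_zero_zero]
  obtain ⟨s, hs, hsK, hsL, hsM⟩ := exists_le_halfIntegral_mul hp hK hKc hK0 hL hLc hL0
    (Or.inl rfl) (ENNReal.mul_lt_top (halfIntegral_lt_top hp hK (σ := -1) (h0 hK0))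
      (halfIntegral_lt_top hp hL (σ := 1) (h0 hL0)))
  obtain ⟨u, hu, huK, huL, huM⟩ := exists_le_halfIntegral_mul hp hK hKc hK0 hL hLc hL0
    (Or.inr rfl) (ENNReal.mul_lt_top (halfIntegral_lt_top hp hK (σ := 1) (h0 hK0))
      (halfIntegral_lt_top hp hL (σ := -1) (h0 hL0)))
  simp only [one_mul, neg_neg, neg_mul] at hsK hsL huK huL hsM huM
  have hmem : ∀ x ∈ Icc (-u) s, (x, (0 : ℝ)) ∈ interior K ∧ (-x, (0 : ℝ)) ∈ interior L := by
    have hconv : Convex ℝ {x : ℝ | (x, (0 : ℝ)) ∈ interior K ∧ (-x, (0 : ℝ)) ∈ interior L} := by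
      have e : {x : ℝ | (x, (0 : ℝ)) ∈ interior K ∧ (-x, (0 : ℝ)) ∈ interior L} =
          LinearMap.inl ℝ ℝ ℝ ⁻¹' interior K ∩ (-LinearMap.inl ℝ ℝ ℝ) ⁻¹' interior L := by
        ext x
        simp
      rw [e]
      exact (hKc.interior.linear_preimage _).inter (hLc.interior.linear_preimage _)
    exact fun x hx => hconv.ordConnected.out ⟨huK, by rwa [neg_neg]⟩ ⟨hsK, hsL⟩ hx
  suffices ∃ x ∈ Icc (-u) s, halfIntegral p K 1 x * halfIntegral p L (-1) x =
      halfIntegral p K (-1) (-x) * halfIntegral p L 1 (-x) by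
    obtain ⟨x, hx, hxe⟩ := this
    exact ⟨x, (hmem x hx).1, (hmem x hx).2, hxe⟩
  refine isPreconnected_Icc.intermediate_value₂ (a := -u) (b := s)
    ⟨le_rfl, by linarith⟩ ⟨by linarith, le_rfl⟩ ?_ ?_ ?_ ?_
  · intro x hx
    obtain ⟨h1, h2⟩ := hmem x hx
    have h1' : (1 * x, (0 : ℝ)) ∈ interior K := by rwa [one_mul]
    have h2' : (-1 * x, (0 : ℝ)) ∈ interior L := by rwa [neg_one_mul]
    exact (ENNReal.Tendsto.mul (continuousAt_halfIntegral hp hK h1')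
      (Or.inr (halfIntegral_lt_top hp hL h2').ne) (continuousAt_halfIntegral hp hL h2')
      (Or.inr (halfIntegral_lt_top hp hK h1').ne)).mono_left nhdsWithin_le_nhds
  · intro x hx
    obtain ⟨h1, h2⟩ := hmem x hx
    have h1' : (-1 * -x, (0 : ℝ)) ∈ interior K := by rwa [neg_mul_neg, one_mul]
    have h2' : (1 * -x, (0 : ℝ)) ∈ interior L := by rwa [one_mul]
    have hn : ContinuousAt (fun x : ℝ => -x) x := continuousAt_neg
    exact (ENNReal.Tendsto.mul
      ((continuousAt_halfIntegral hp hK h1').comp (f := fun x : ℝ => -x) hn)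
      (Or.inr (halfIntegral_lt_top hp hL h2').ne)
      ((continuousAt_halfIntegral hp hL h2').comp (f := fun x : ℝ => -x) hn)
      (Or.inr (halfIntegral_lt_top hp hK h1').ne)).mono_left nhdsWithin_le_nhds
  · simp only [neg_neg]
    refine le_trans ?_ huM
    exact mul_le_mul' (halfIntegral_mono p K 1 (by linarith))
      (halfIntegral_mono p L (-1) (by linarith))
  · refine le_trans ?_ hsM
    exact mul_le_mul' (halfIntegral_mono p K (-1) (by linarith))
      (halfIntegral_mono p L 1 (by linarith))

/-- Proposition 5.6, balancing: for a Mahler sliding family `P(·)` with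
`0 ∈ int P̂` and `t, t' ∈ I`, there is `x₀` so that the `L^p`-polars of `P(t)-(x₀,0)` and
`P(t')+(x₀,0)` have proportional right/left areas (all four being finite). -/
theorem balancing_proposition (p : ℝ) (hp : 0 < p)
    (x1 x3 y1 y2 : ℝ) (hx : x3 < x1) (hy : y1 < y2)
    (Phat : Set (ℝ × ℝ)) (hPcomp : IsCompact Phat) (hPconv : Convex ℝ Phat)
    (hPint : (interior Phat).Nonempty)
    (hseg : segment ℝ ((x3 : ℝ), y1) ((x1 : ℝ), y1) ⊆ Phat)
    (h0 : (0 : ℝ × ℝ) ∈ interior Phat)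
    (I : Set ℝ) (hI : Convex ℝ I)
    (Δ : ℝ → Set (ℝ × ℝ))
    (hΔ : ∀ t, Δ t = convexHull ℝ ({(x1, y1), (t, y2), (x3, y1)} : Set (ℝ × ℝ)))
    (P : ℝ → Set (ℝ × ℝ))
    (hP : ∀ t, P t = convexHull ℝ (Phat ∪ ({(t, y2)} : Set (ℝ × ℝ))))
    (hdecomp : ∀ t ∈ I, P t = Phat ∪ Δ t ∧ interior Phat ∩ interior (Δ t) = ∅)
    (t t' : ℝ) (ht : t ∈ I) (ht' : t' ∈ I) :
    ∃ x0 : ℝ, (((x0 : ℝ), (0 : ℝ)) ∈ interior (P t)) ∧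
      (((-x0 : ℝ), (0 : ℝ)) ∈ interior (P t')) ∧
      letI A : Set (ℝ × ℝ) := lpPolar p ((fun q => q - ((x0 : ℝ), (0 : ℝ))) '' P t)
      letI B : Set (ℝ × ℝ) := lpPolar p ((fun q => q + ((x0 : ℝ), (0 : ℝ))) '' P t')
      volume (A ∩ {q : ℝ × ℝ | 0 < q.1}) < ⊤ ∧
      volume (A ∩ {q : ℝ × ℝ | q.1 < 0}) < ⊤ ∧
      volume (B ∩ {q : ℝ × ℝ | 0 < q.1}) < ⊤ ∧
      volume (B ∩ {q : ℝ × ℝ | q.1 < 0}) < ⊤ ∧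
      volume (A ∩ {q : ℝ × ℝ | 0 < q.1}) * volume (B ∩ {q : ℝ × ℝ | q.1 < 0}) =
        volume (A ∩ {q : ℝ × ℝ | q.1 < 0}) * volume (B ∩ {q : ℝ × ℝ | 0 < q.1}) := by
  have hcomp : ∀ u ∈ I, IsCompact (P u) := by
    intro u hu
    rw [(hdecomp u hu).1, hΔ]
    exact hPcomp.union (Set.Finite.isCompact_convexHull ℝ (by simp))
  have hconv : ∀ u, Convex ℝ (P u) := fun u => by
    rw [hP]
    exact convex_convexHull ℝ _
  have hzero : ∀ u, (0 : ℝ × ℝ) ∈ interior (P u) := fun u => by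
    rw [hP]
    exact interior_mono (subset_union_left.trans (subset_convexHull ℝ _)) h0
  obtain ⟨x, hxK, hxL, h⟩ := exists_balanced_halfIntegral hp (hcomp t ht) (hconv t) (hzero t)
    (hcomp t' ht') (hconv t') (hzero t')
  refine ⟨x, hxK, hxL, ?_⟩
  have hpos : {q : ℝ × ℝ | 0 < q.1} = {q : ℝ × ℝ | 0 < (1 : ℝ) * q.1} := by simp
  have hneg : {q : ℝ × ℝ | q.1 < 0} = {q : ℝ × ℝ | 0 < (-1 : ℝ) * q.1} := by simp
  have h1 : (1 : ℝ) * 1 = 1 := by norm_num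
  have h2 : (-1 : ℝ) * -1 = 1 := by norm_num
  rw [hpos, hneg, image_add_eq_image_sub_neg,
    volume_lpPolar_image_sub_inter hp (hcomp t ht) hxK h1,
    volume_lpPolar_image_sub_inter hp (hcomp t ht) hxK h2,
    volume_lpPolar_image_sub_inter hp (hcomp t' ht') hxL h1,
    volume_lpPolar_image_sub_inter hp (hcomp t' ht') hxL h2]
  refine ⟨?_, ?_, ?_, ?_, ?_⟩
  iterate 2
    refine ENNReal.mul_lt_top ENNReal.ofReal_lt_top (halfIntegral_lt_top hp (hcomp t ht) ?_)
    simpa using hxK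
  iterate 2
    refine ENNReal.mul_lt_top ENNReal.ofReal_lt_top (halfIntegral_lt_top hp (hcomp t' ht') ?_)
    simpa using hxL
  simp only [one_mul, neg_mul, neg_neg]
  rw [mul_mul_mul_comm, h, mul_mul_mul_comm]
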